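/- arXiv:2010.03676 — 2 statements merged into one kernel-verified Lean document; each statement's English description precedes it below -/
import Mathlib

section
/- Let A be a subgroup of a group Γ, and let x be an element of Γ. If localrank(A) < ∞ and the homomorphism ι_{A,x} : A ∗ ⟨t⟩ → Γ is injective, then localrank(⟨A, x⟩) > localrank(A). Conversely, if A is strongly closable and localrank(⟨A, x⟩) > localrank(A), then ι_{A,x} is injective. -/
/-- The rank of a subgroup, as an extended natural number: the minimal cardinality of a
finite generating set, or `⊤` if the subgroup is not finitely generated. -/
noncomputable def subgroupRank {Γ : Type*} [Group Γ] (H : Subgroup Γ) : ℕ∞ :=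
  ⨅ (S : Finset Γ) (_ : Subgroup.closure (S : Set Γ) = H), (S.card : ℕ∞)

/-- `A` has local rank at most `r` if every finitely generated subgroup of `A` is contained
in a subgroup of `A` of rank at most `r`. -/
def LocalRankLE {Γ : Type*} [Group Γ] (A : Subgroup Γ) (r : ℕ) : Prop :=
  ∀ B : Subgroup Γ, B ≤ A → B.FG →
    ∃ C : Subgroup Γ, C ≤ A ∧ B ≤ C ∧ subgroupRank C ≤ (r : ℕ∞)

/-- The local rank of a subgroup: the least `r` such that `LocalRankLE A r`, or `⊤` if
there is no such `r`. -/
noncomputable def localRank {Γ : Type*} [Group Γ] (A : Subgroup Γ) : ℕ∞ :=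
  ⨅ (r : ℕ) (_ : LocalRankLE A r), (r : ℕ∞)

/-- A group is `k`-free if every subgroup of rank at most `k` is free. -/
def KFree (Γ : Type*) [Group Γ] (k : ℕ) : Prop :=
  ∀ H : Subgroup Γ, subgroupRank H ≤ (k : ℕ∞) → IsFreeGroup H

/-- The index of freedom of `Γ`: the supremum of all `k` such that `Γ` is `k`-free. -/
noncomputable def iof (Γ : Type*) [Group Γ] : ℕ∞ :=
  ⨆ (k : ℕ) (_ : KFree Γ k), (k : ℕ∞)

/-- A subgroup `A` of `Γ` is strongly closable if `localRank A < iof Γ`. -/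
def StronglyClosable {Γ : Type*} [Group Γ] (A : Subgroup Γ) : Prop :=
  localRank A < iof Γ

/-- A subgroup `A` of `Γ` is closable if it has finite local rank and there is some `z ∈ Γ`
with `localRank ⟨A, z⟩ < iof Γ`. -/
def Closable {Γ : Type*} [Group Γ] (A : Subgroup Γ) : Prop :=
  localRank A < ⊤ ∧ ∃ z : Γ, localRank (A ⊔ Subgroup.closure {z}) < iof Γ

/-- An element `x` of `Γ` is `A`-admissible if `⟨A, x⟩` is strongly closable and
`localRank ⟨A, x⟩ ≤ localRank A`. -/
def Admissible {Γ : Type*} [Group Γ] (A : Subgroup Γ) (x : Γ) : Prop :=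
  StronglyClosable (A ⊔ Subgroup.closure {x}) ∧
    localRank (A ⊔ Subgroup.closure {x}) ≤ localRank A

/-- A sequence `x₁, …, x_m` is `A`-admissible if each `x_i` is `⟨A, x₁, …, x_{i-1}⟩`-admissible. -/
def AdmissibleSeq {Γ : Type*} [Group Γ] : Subgroup Γ → List Γ → Prop
  | _, [] => True
  | A, x :: xs => Admissible A x ∧ AdmissibleSeq (A ⊔ Subgroup.closure {x}) xs

/-- `clo A` is the set of all `x ∈ Γ` which occur as the last term of an `A`-admissible
sequence. -/
def clo {Γ : Type*} [Group Γ] (A : Subgroup Γ) : Set Γ :=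
  { x | ∃ l : List Γ, AdmissibleSeq A (l ++ [x]) }

/-- The homomorphism `ι_{A,x}` from the free product `A ∗ ⟨t⟩` to `Γ` restricting to the
inclusion on `A` and sending `t` to `x`. -/
noncomputable def iotaAX {Γ : Type*} [Group Γ] (A : Subgroup Γ) (x : Γ) :
    Monoid.Coprod (↥A) (Multiplicative ℤ) →* Γ :=
  Monoid.Coprod.lift A.subtype (zpowersHom Γ x)

/-- Elements `g 0, …, g (m-1)` of `Γ` are independent if they freely generate a free subgroup,
i.e. the induced homomorphism from the free group on `m` generators is injective. -/
def Independent {Γ : Type*} [Group Γ] {m : ℕ} (g : Fin m → Γ) : Prop :=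
  Function.Injective (FreeGroup.lift g : FreeGroup (Fin m) →* Γ)

universe u

section FreeHopf

theorem WR.resFinite {I : Type u} (w : FreeGroup I) (hw : w ≠ 1) :
    ∃ (T : Type u) (_ : Finite T) (ψ : FreeGroup I →* Equiv.Perm T), ψ w ≠ 1 := by
  classical
  obtain ⟨L, rfl⟩ : ∃ L, FreeGroup.mk L = w := ⟨w.toWord, FreeGroup.mk_toWord⟩
  let T : Set (FreeGroup I) := FreeGroup.mk '' {l | l ∈ L.tails}
  have hT : Finite T := ((List.finite_toSet L.tails).image _).to_subtype
  have key : ∀ a : I, ∃ σ : Equiv.Perm T, ∀ x : T, ∀ h : FreeGroup.of a * x.1 ∈ T,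
      σ x = ⟨FreeGroup.of a * x.1, h⟩ := by
    intro a
    let s : Set T := {x | FreeGroup.of a * x.1 ∈ T}
    let f : s ↪ T := ⟨fun x => ⟨FreeGroup.of a * x.1.1, x.2⟩, by
      intro x y h
      have := congrArg Subtype.val h
      exact Subtype.ext (Subtype.ext (mul_left_cancel this))⟩
    obtain ⟨g, hg⟩ := Cardinal.extend_function_finite f ⟨Equiv.refl _⟩
    exact ⟨g, fun x h => hg ⟨x, h⟩⟩
  choose σ hσ using key
  refine ⟨T, hT, FreeGroup.lift σ, ?_⟩
  have h1 : (1 : FreeGroup I) ∈ T := ⟨[], by simp [List.mem_tails], rfl⟩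
  have main : ∀ l : List (I × Bool), ∀ h : l <:+ L,
      (FreeGroup.lift σ (FreeGroup.mk l)) ⟨1, h1⟩
        = ⟨FreeGroup.mk l, ⟨l, by simpa [List.mem_tails] using h, rfl⟩⟩ := by
    intro l
    induction l with
    | nil => intro h; rfl
    | cons p l ih =>
      intro h
      have hl : l <:+ L := (List.suffix_cons p l).trans h
      have e : FreeGroup.mk (p :: l) = FreeGroup.mk [p] * FreeGroup.mk l := by
        rw [FreeGroup.mul_mk]; rfl
      have hm : FreeGroup.mk (p :: l) ∈ T := ⟨p :: l, by simpa [List.mem_tails] using h, rfl⟩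
      have hm' : FreeGroup.mk l ∈ T := ⟨l, by simpa [List.mem_tails] using hl, rfl⟩
      obtain ⟨a, b⟩ := p
      have : FreeGroup.lift σ (FreeGroup.mk ((a, b) :: l)) ⟨1, h1⟩
          = FreeGroup.lift σ (FreeGroup.mk [(a, b)])
            ⟨FreeGroup.mk l, hm'⟩ := by
        rw [e, map_mul, Equiv.Perm.mul_apply, ih hl]
      rw [this]
      cases b with
      | true =>
        have e2 : FreeGroup.mk [(a, true)] = FreeGroup.of a := rfl
        rw [e2, FreeGroup.lift_apply_of]
        rw [e2] at e
        rw [hσ a ⟨FreeGroup.mk l, hm'⟩ (by rw [← e]; exact hm)]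
        exact Subtype.ext e.symm
      | false =>
        have e2 : FreeGroup.mk [(a, false)] = (FreeGroup.of a)⁻¹ := rfl
        rw [e2, map_inv, FreeGroup.lift_apply_of]
        rw [e2] at e
        rw [Equiv.Perm.inv_eq_iff_eq]
        have e3 : FreeGroup.of a * FreeGroup.mk ((a, false) :: l) = FreeGroup.mk l := by
          rw [e]; simp
        rw [hσ a ⟨_, hm⟩ (by show FreeGroup.of a * FreeGroup.mk ((a, false) :: l) ∈ T
                             rw [e3]; exact hm')]
        exact Subtype.ext e3.symm
  intro h
  have := main L (List.suffix_refl L)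
  rw [h] at this
  exact hw (congrArg Subtype.val this).symm

theorem WR.hopf {I : Type u} [Finite I] (f : FreeGroup I →* FreeGroup I)
    (hf : Function.Surjective f) : Function.Injective f := by
  rw [injective_iff_map_eq_one]
  intro w h
  by_contra hw
  obtain ⟨T, hT, ψ, hψ⟩ := WR.resFinite w hw
  have : Finite (FreeGroup I →* Equiv.Perm T) :=
    Finite.of_equiv (I → Equiv.Perm T) FreeGroup.lift
  have inj : Function.Injective (fun χ : FreeGroup I →* Equiv.Perm T => χ.comp f) := by
    intro χ χ' h
    exact (MonoidHom.cancel_right hf).1 h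
  obtain ⟨χ, rfl⟩ := (Finite.injective_iff_surjective.1 inj) ψ
  exact hψ (by simp [h])

theorem WR.rank_le {I X : Type*} [Finite I] (f : FreeGroup I →* FreeGroup X)
    (hf : Function.Surjective f) : Finite X ∧ Nat.card X ≤ Nat.card I := by
  have inj : Function.Injective (fun χ : X → Multiplicative (ZMod 2) =>
      FreeGroup.lift.symm ((FreeGroup.lift χ).comp f)) := by
    intro χ χ' h
    exact FreeGroup.lift.injective ((MonoidHom.cancel_right hf).1 (FreeGroup.lift.symm.injective h))
  have fin : Finite (X → Multiplicative (ZMod 2)) := Finite.of_injective _ inj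
  have finX : Finite X := by
    classical
    refine Finite.of_injective
      (fun x : X => (Pi.mulSingle x (Multiplicative.ofAdd 1) : X → Multiplicative (ZMod 2))) ?_
    intro x y h
    by_contra hxy
    have := congrFun h x
    simp [hxy] at this
  refine ⟨finX, ?_⟩
  have := Nat.card_le_card_of_injective _ inj
  rw [Nat.card_fun, Nat.card_fun] at this
  have h2 : Nat.card (Multiplicative (ZMod 2)) = 2 := by
    rw [Nat.card_congr Multiplicative.toAdd]; simp
  rw [h2] at this
  exact (Nat.pow_le_pow_iff_right (by norm_num)).1 this

end FreeHopf

section Misc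

theorem WR.fin_support {A G : Type*} [Group A] [Group G] (i : A →* G) (t w : G)
    (hw : w ∈ i.range ⊔ Subgroup.closure {t}) :
    ∃ S : Finset A, w ∈ Subgroup.closure (i '' S) ⊔ Subgroup.closure {t} := by
  classical
  have mono : ∀ S S' : Finset A, S ⊆ S' → Subgroup.closure (i '' S) ⊔ Subgroup.closure {t}
      ≤ Subgroup.closure (i '' S') ⊔ Subgroup.closure {t} := fun S S' h =>
    sup_le_sup_right (Subgroup.closure_mono (Set.image_mono (by exact_mod_cast h))) _
  let K : Subgroup G :=
    { carrier := {w | ∃ S : Finset A, w ∈ Subgroup.closure (i '' S) ⊔ Subgroup.closure {t}}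
      one_mem' := ⟨∅, one_mem _⟩
      mul_mem' := by
        rintro a b ⟨S, hS⟩ ⟨S', hS'⟩
        exact ⟨S ∪ S', mul_mem (mono _ _ Finset.subset_union_left hS)
          (mono _ _ Finset.subset_union_right hS')⟩
      inv_mem' := by
        rintro a ⟨S, hS⟩
        exact ⟨S, inv_mem hS⟩ }
  have : i.range ⊔ Subgroup.closure {t} ≤ K := by
    refine sup_le ?_ ?_
    · rintro _ ⟨a, rfl⟩
      exact ⟨{a}, Subgroup.mem_sup_left (Subgroup.subset_closure ⟨a, by simp, rfl⟩)⟩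
    · rw [Subgroup.closure_le]
      rintro _ rfl
      exact ⟨∅, Subgroup.mem_sup_right (Subgroup.subset_closure rfl)⟩
  exact this hw

theorem WR.rank_le_iff {Γ : Type*} [Group Γ] (H : Subgroup Γ) (r : ℕ) :
    subgroupRank H ≤ r ↔ ∃ S : Finset Γ, Subgroup.closure (S : Set Γ) = H ∧ S.card ≤ r := by
  constructor
  · intro h
    by_contra hn
    push Not at hn
    have : ((r + 1 : ℕ) : ℕ∞) ≤ subgroupRank H := by
      refine le_iInf₂ fun S hS => ?_
      exact_mod_cast hn S hS
    have := this.trans h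
    have : r + 1 ≤ r := by exact_mod_cast this
    omega
  · rintro ⟨S, hS, hr⟩
    exact (iInf₂_le S hS).trans (by exact_mod_cast hr)

theorem WR.localRankLE_mono {Γ : Type*} [Group Γ] {A : Subgroup Γ} {r s : ℕ} (h : r ≤ s)
    (hA : LocalRankLE A r) : LocalRankLE A s := by
  intro B hB hf
  obtain ⟨C, h1, h2, h3⟩ := hA B hB hf
  exact ⟨C, h1, h2, h3.trans (by exact_mod_cast h)⟩

theorem WR.localRank_le_iff {Γ : Type*} [Group Γ] (A : Subgroup Γ) (r : ℕ) :
    localRank A ≤ r ↔ LocalRankLE A r := by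
  constructor
  · intro h
    by_contra hn
    have : ((r + 1 : ℕ) : ℕ∞) ≤ localRank A := by
      refine le_iInf₂ fun s hs => ?_
      have : r + 1 ≤ s := by
        by_contra hlt
        exact hn (WR.localRankLE_mono (by omega) hs)
      exact_mod_cast this
    have := this.trans h
    have : r + 1 ≤ r := by exact_mod_cast this
    omega
  · intro h
    exact iInf₂_le r h

theorem WR.range_sup {A : Type*} [Group A] :
    (Monoid.Coprod.inl : A →* Monoid.Coprod A (Multiplicative ℤ)).range ⊔
      Subgroup.closure {Monoid.Coprod.inr (Multiplicative.ofAdd (1 : ℤ))} = ⊤ := by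
  rw [← Monoid.Coprod.range_inl_sup_range_inr]
  congr 1
  apply le_antisymm
  · rw [Subgroup.closure_le]
    rintro _ rfl
    exact ⟨_, rfl⟩
  · rintro _ ⟨m, rfl⟩
    have : m = (Multiplicative.ofAdd (1 : ℤ)) ^ (Multiplicative.toAdd m) := by
      rw [← ofAdd_zsmul]; simp
    rw [this, map_zpow (Monoid.Coprod.inr : Multiplicative ℤ →* Monoid.Coprod A (Multiplicative ℤ))]
    apply Subgroup.zpow_mem
    exact Subgroup.subset_closure (Set.mem_singleton _)

end Misc

theorem WR.part2 {Γ : Type*} [Group Γ] (A : Subgroup Γ) (x : Γ) (hA : StronglyClosable A)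
    (hlt : localRank A < localRank (A ⊔ Subgroup.closure {x})) :
    Function.Injective (iotaAX A x) := by
  classical
  rw [injective_iff_map_eq_one]
  intro w hw
  by_contra hw1
  obtain ⟨r, hr⟩ : ∃ r : ℕ, localRank A = r := by
    have : localRank A ≠ ⊤ := (hlt.trans_le le_top).ne
    exact ⟨_, (ENat.natCast_toNat this).symm⟩
  have hAr : LocalRankLE A r := (WR.localRank_le_iff A r).1 hr.le
  obtain ⟨k, hk, hkr⟩ : ∃ k : ℕ, KFree Γ k ∧ r + 1 ≤ k := by
    unfold StronglyClosable iof at hA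
    rw [hr, lt_iSup_iff] at hA
    obtain ⟨k, hk⟩ := hA
    rw [lt_iSup_iff] at hk
    obtain ⟨hk, h⟩ := hk
    exact ⟨k, hk, by exact_mod_cast h⟩
  refine absurd hlt (not_lt.2 ?_)
  rw [hr, WR.localRank_le_iff]
  intro E hE hEfg
  -- finite support of w
  obtain ⟨S0, hS0⟩ := WR.fin_support Monoid.Coprod.inl
    (Monoid.Coprod.inr (Multiplicative.ofAdd (1 : ℤ))) w (by rw [WR.range_sup]; trivial)
  obtain ⟨S1, hS1⟩ : ∃ S1 : Finset A, E ≤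
      Subgroup.closure (A.subtype '' S1) ⊔ Subgroup.closure {x} := by
    obtain ⟨S, rfl⟩ := hEfg
    have : ∀ s : S, ∃ S1 : Finset A, (s : Γ) ∈
      Subgroup.closure (A.subtype '' S1) ⊔ Subgroup.closure {x} := by
      intro s
      apply WR.fin_support
      rw [Subgroup.range_subtype]
      exact hE (Subgroup.subset_closure s.2)
    choose F hF using this
    refine ⟨Finset.univ.biUnion F, ?_⟩
    rw [Subgroup.closure_le]
    intro s hs
    refine (sup_le_sup_right (Subgroup.closure_mono (Set.image_mono ?_)) _ :
      _ ≤ _) (hF ⟨s, hs⟩)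
    exact_mod_cast Finset.subset_biUnion_of_mem F (Finset.mem_univ _)
  obtain ⟨C, hCA, hBC, hCr⟩ := hAr (Subgroup.closure (A.subtype '' (S0 ∪ S1 : Finset A)))
    (by rw [Subgroup.closure_le]; rintro _ ⟨a, _, rfl⟩; exact a.2)
    ⟨(S0 ∪ S1).image A.subtype, by push_cast; rfl⟩
  obtain ⟨S, hSC, hSr⟩ := (WR.rank_le_iff C r).1 hCr
  set H := C ⊔ Subgroup.closure {x} with hH
  have hEH : E ≤ H := by
    refine hS1.trans (sup_le_sup_right (le_trans ?_ hBC) _)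
    refine Subgroup.closure_mono (Set.image_mono ?_)
    exact_mod_cast Finset.subset_union_right
  have hHA : H ≤ A ⊔ Subgroup.closure {x} := sup_le_sup_right hCA _
  refine ⟨H, hHA, hEH, ?_⟩
  have hHcl : Subgroup.closure ((insert x S : Finset Γ) : Set Γ) = H := by
    rw [Finset.coe_insert, Set.insert_eq, Subgroup.closure_union, hSC, sup_comm]
  have hHfree : IsFreeGroup H := hk H ((WR.rank_le_iff H k).2
    ⟨insert x S, hHcl, (Finset.card_insert_le _ _).trans (by omega)⟩)
  let X := IsFreeGroup.Generators H
  let e : H ≃* FreeGroup X := IsFreeGroup.toFreeGroup H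
  have hxH : x ∈ H := Subgroup.mem_sup_right (Subgroup.subset_closure rfl)
  have hsC : ∀ s : S, s.1 ∈ C := fun s => hSC ▸ Subgroup.subset_closure s.2
  have hsH : ∀ s : S, s.1 ∈ H := fun s => Subgroup.mem_sup_left (hsC s)
  let g : Option S → H := fun o => o.elim ⟨x, hxH⟩ (fun s => ⟨s.1, hsH s⟩)
  let f : FreeGroup (Option S) →* H := FreeGroup.lift g
  have hfs : Function.Surjective f := by
    have : (H.subtype.comp f).range = H := by
      apply le_antisymm
      · rintro _ ⟨u, rfl⟩; exact (f u).2
      · conv_lhs => rw [← hHcl]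
        rw [Subgroup.closure_le]
        intro y hy
        rcases Finset.mem_insert.1 (Finset.mem_coe.1 hy) with rfl | hy
        · exact ⟨FreeGroup.of none, by simp [f, g]⟩
        · exact ⟨FreeGroup.of (some ⟨y, hy⟩), by simp [f, g]⟩
    intro h
    obtain ⟨u, hu⟩ : h.1 ∈ (H.subtype.comp f).range := by rw [this]; exact h.2
    exact ⟨u, Subtype.ext hu⟩
  obtain ⟨finX, hX⟩ := WR.rank_le (e.toMonoidHom.comp f) (e.surjective.comp hfs)
  have hopt : Nat.card (Option S) = S.card + 1 := by simp
  rw [hopt] at hX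
  by_cases hXr : Nat.card X ≤ r
  · rw [WR.rank_le_iff]
    have := Fintype.ofFinite X
    refine ⟨Finset.univ.image (fun i : X => ((e.symm (FreeGroup.of i) : H) : Γ)), ?_, ?_⟩
    · have h1 : Set.range (fun i : X => ((e.symm (FreeGroup.of i) : H) : Γ))
        = (H.subtype.comp e.symm.toMonoidHom) '' Set.range FreeGroup.of := by
        rw [← Set.range_comp]; rfl
      rw [Finset.coe_image, Finset.coe_univ, Set.image_univ, h1, ← MonoidHom.map_closure,
        FreeGroup.closure_range_of, ← MonoidHom.range_eq_map]
      ext y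
      constructor
      · rintro ⟨u, rfl⟩; exact (e.symm u).2
      · intro hy; exact ⟨e ⟨y, hy⟩, by simp⟩
    · refine Finset.card_image_le.trans ?_
      rw [Finset.card_univ, ← Nat.card_eq_fintype_card]; exact hXr
  · exfalso
    have hcard : Nat.card X = Nat.card (Option S) := by rw [hopt]; omega
    let j : X ≃ Option S := (Finite.card_eq.1 hcard).some
    have hinj : Function.Injective f := by
      have := WR.hopf (((FreeGroup.freeGroupCongr j).toMonoidHom.comp e.toMonoidHom).comp f)
        (((FreeGroup.freeGroupCongr j).surjective.comp e.surjective).comp hfs)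
      exact fun a b h => this (by simp only [MonoidHom.comp_apply, h])
    let θ : FreeGroup (Option S) →* Monoid.Coprod A (Multiplicative ℤ) :=
      FreeGroup.lift (fun o => o.elim (Monoid.Coprod.inr (Multiplicative.ofAdd (1 : ℤ)))
        (fun s => Monoid.Coprod.inl ⟨s.1, hCA (hsC s)⟩))
    have hθ : (iotaAX A x).comp θ = H.subtype.comp f := by
      ext o
      cases o <;> simp [θ, f, g, iotaAX]
    have hwθ : w ∈ θ.range := by
      refine (sup_le ?_ ?_ : _ ≤ θ.range) hS0
      · rw [Subgroup.closure_le]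
        rintro _ ⟨a, ha, rfl⟩
        have haC : a.1 ∈ C := hBC (Subgroup.subset_closure ⟨a, by
          simp only [Finset.coe_union]; exact Or.inl ha, rfl⟩)
        have hle : C ≤ (θ.range.comap Monoid.Coprod.inl).map A.subtype := by
          rw [← hSC, Subgroup.closure_le]
          intro s hs
          refine ⟨⟨s, hCA (hsC ⟨s, hs⟩)⟩, ⟨FreeGroup.of (some ⟨s, hs⟩), ?_⟩, rfl⟩
          simp [θ]
        obtain ⟨a', ha', h⟩ := hle haC
        have : a' = a := Subtype.ext h
        rw [← this]; exact ha'
      · rw [Subgroup.closure_le]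
        rintro _ rfl
        exact ⟨FreeGroup.of none, by simp [θ]⟩
    obtain ⟨u, rfl⟩ := hwθ
    have h1 : H.subtype (f u) = 1 := by
      rw [← hw]; exact (DFunLike.congr_fun hθ u).symm
    have h2 : f u = 1 := Subtype.ext h1
    have : u = 1 := hinj (by rw [h2, map_one])
    exact hw1 (by rw [this, map_one])

section Fold

abbrev WR.G (A : Type u) [Group A] := Monoid.Coprod A (Multiplicative ℤ)

def WR.t (A : Type u) [Group A] : WR.G A := Monoid.Coprod.inr (Multiplicative.ofAdd (1 : ℤ))

abbrev WR.RT (A : Type u) := Finset (ℕ × A × ℕ)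
abbrev WR.ET (A : Type u) := Finset ((A × ℕ) × (A × ℕ))

variable {A : Type u} [Group A]

/-- `z` satisfies the relations `R` and `E` in the set `Z` with action `φ`. -/
def WR.Model {Z : Type u} (φ : WR.G A →* Equiv.Perm Z) (z : ℕ → Z) (R : WR.RT A) (E : WR.ET A) :
    Prop :=
  (∀ v g w, (v, g, w) ∈ R → φ (Monoid.Coprod.inl g) (z v) = z w) ∧
  (∀ a v b w, ((a, v), (b, w)) ∈ E →
    φ (WR.t A) (φ (Monoid.Coprod.inl a) (z v)) = φ (Monoid.Coprod.inl b) (z w))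

theorem WR.Model.mono {Z : Type u} {φ : WR.G A →* Equiv.Perm Z} {z : ℕ → Z} {R R' : WR.RT A}
    {E E' : WR.ET A} (h : WR.Model φ z R' E') (hR : R ⊆ R') (hE : E ⊆ E') : WR.Model φ z R E :=
  ⟨fun v g w hm => h.1 v g w (hR hm), fun a v b w hm => h.2 a v b w (hE hm)⟩

def WR.Conn (n : ℕ) (R : WR.RT A) (E : WR.ET A) : Prop :=
  ∀ (Z : Type u) (z : ℕ → Z), WR.Model (1 : WR.G A →* Equiv.Perm Z) z R E → ∀ v ≤ n, z v = z 0

def WR.Good (n k : ℕ) (R : WR.RT A) (E : WR.ET A) : Prop :=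
  R.card + E.card ≤ n + k ∧ WR.Conn n R E

def WR.P (g : WR.G A) : Prop :=
  ∀ (n k : ℕ) (R : WR.RT A) (E : WR.ET A), WR.Good n k R E → ∀ v ≤ n,
    ∃ (n' : ℕ) (R' : WR.RT A) (E' : WR.ET A), WR.Good n' k R' E' ∧ R ⊆ R' ∧ E ⊆ E' ∧
      ∃ w ≤ n', ∀ (Z : Type u) (φ : WR.G A →* Equiv.Perm Z) (z : ℕ → Z), WR.Model φ z R' E' →
        φ g (z v) = z w

theorem WR.P_inl (a : A) : WR.P (Monoid.Coprod.inl a : WR.G A) := by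
  classical
  intro n k R E ⟨h1, h2⟩ v hv
  refine ⟨n + 1, insert (v, a, n + 1) R, E, ⟨?_, ?_⟩, Finset.subset_insert _ _, subset_rfl,
    n + 1, le_rfl, ?_⟩
  · have := Finset.card_insert_le (v, a, n + 1) R
    omega
  · intro Z z hM u hu
    have hold := h2 Z z (hM.mono (Finset.subset_insert _ _) subset_rfl)
    rcases Nat.lt_or_ge n u with h | h
    · obtain rfl : u = n + 1 := by omega
      rw [← hold v hv, ← hM.1 v a (n + 1) (Finset.mem_insert_self _ _)]; rfl
    · exact hold u h
  · intro Z φ z hM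
    exact hM.1 _ _ _ (Finset.mem_insert_self _ _)

theorem WR.P_t : WR.P (WR.t A) := by
  classical
  intro n k R E ⟨h1, h2⟩ v hv
  refine ⟨n + 1, R, insert ((1, v), (1, n + 1)) E, ⟨?_, ?_⟩, subset_rfl, Finset.subset_insert _ _,
    n + 1, le_rfl, ?_⟩
  · have := Finset.card_insert_le ((1, v), (1, n + 1)) E
    omega
  · intro Z z hM u hu
    have hold := h2 Z z (hM.mono subset_rfl (Finset.subset_insert _ _))
    rcases Nat.lt_or_ge n u with h | h
    · obtain rfl : u = n + 1 := by omega
      have := hM.2 _ _ _ _ (Finset.mem_insert_self _ _)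
      rw [← hold v hv]
      exact this.symm
    · exact hold u h
  · intro Z φ z hM
    simpa using hM.2 _ _ _ _ (Finset.mem_insert_self _ _)

theorem WR.P_t_inv : WR.P (WR.t A)⁻¹ := by
  classical
  intro n k R E ⟨h1, h2⟩ v hv
  refine ⟨n + 1, R, insert ((1, n + 1), (1, v)) E, ⟨?_, ?_⟩, subset_rfl, Finset.subset_insert _ _,
    n + 1, le_rfl, ?_⟩
  · have := Finset.card_insert_le ((1, n + 1), (1, v)) E
    omega
  · intro Z z hM u hu
    have hold := h2 Z z (hM.mono subset_rfl (Finset.subset_insert _ _))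
    rcases Nat.lt_or_ge n u with h | h
    · obtain rfl : u = n + 1 := by omega
      have := hM.2 _ _ _ _ (Finset.mem_insert_self _ _)
      rw [← hold v hv]
      exact this
    · exact hold u h
  · intro Z φ z hM
    have := hM.2 _ _ _ _ (Finset.mem_insert_self _ _)
    rw [map_inv, Equiv.Perm.inv_eq_iff_eq]
    simpa using this.symm

theorem WR.P_mul {g h : WR.G A} (hg : WR.P g) (hh : WR.P h) : WR.P (g * h) := by
  intro n k R E hG v hv
  obtain ⟨n1, R1, E1, hG1, hR1, hE1, w1, hw1, m1⟩ := hh n k R E hG v hv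
  obtain ⟨n2, R2, E2, hG2, hR2, hE2, w2, hw2, m2⟩ := hg n1 k R1 E1 hG1 w1 hw1
  refine ⟨n2, R2, E2, hG2, hR1.trans hR2, hE1.trans hE2, w2, hw2, ?_⟩
  intro Z φ z hM
  rw [map_mul, Equiv.Perm.mul_apply, m1 Z φ z (hM.mono hR2 hE2), m2 Z φ z hM]

theorem WR.P_all (g : WR.G A) : WR.P g := by
  let K : Subgroup (WR.G A) :=
    { carrier := {g | WR.P g ∧ WR.P g⁻¹}
      one_mem' := by
        have := WR.P_inl (1 : A)
        rw [map_one] at this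
        exact ⟨this, by rwa [inv_one]⟩
      mul_mem' := by
        rintro a b ⟨h1, h2⟩ ⟨h3, h4⟩
        refine ⟨WR.P_mul h1 h3, ?_⟩
        rw [mul_inv_rev]
        exact WR.P_mul h4 h2
      inv_mem' := by
        rintro a ⟨h1, h2⟩
        exact ⟨h2, by rwa [inv_inv]⟩ }
  have : (⊤ : Subgroup (WR.G A)) ≤ K := by
    rw [← WR.range_sup]
    refine sup_le ?_ ?_
    · rintro _ ⟨a, rfl⟩
      refine ⟨WR.P_inl a, ?_⟩
      rw [← map_inv]
      exact WR.P_inl a⁻¹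
    · rw [Subgroup.closure_le]
      rintro _ rfl
      exact ⟨WR.P_t, WR.P_t_inv⟩
  exact (this (Subgroup.mem_top g)).1

theorem WR.init (S : Finset (WR.G A)) :
    ∃ (n : ℕ) (R : WR.RT A) (E : WR.ET A), WR.Good n S.card R E ∧
      ∀ (Z : Type u) (φ : WR.G A →* Equiv.Perm Z) (z : ℕ → Z), WR.Model φ z R E →
        ∀ s ∈ S, φ s (z 0) = z 0 := by
  classical
  induction S using Finset.induction_on with
  | empty =>
    refine ⟨0, ∅, ∅, ⟨by simp, ?_⟩, by simp⟩
    intro Z z _ v hv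
    rw [Nat.le_zero.1 hv]
  | insert s S hs ih =>
    obtain ⟨n, R, E, hG, hm⟩ := ih
    obtain ⟨n1, R1, E1, hG1, hR1, hE1, w, hw, m1⟩ := WR.P_all s n _ R E hG 0 (Nat.zero_le _)
    refine ⟨n1, insert (w, 1, 0) R1, E1, ⟨?_, ?_⟩, ?_⟩
    · have := Finset.card_insert_le (w, (1 : A), 0) R1
      rw [Finset.card_insert_of_notMem hs]
      have := hG1.1
      omega
    · intro Z z hM
      exact hG1.2 Z z (hM.mono (Finset.subset_insert _ _) subset_rfl)
    · intro Z φ z hM s' hs'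
      have hM1 := hM.mono (Finset.subset_insert _ _) (subset_refl E1)
      rcases Finset.mem_insert.1 hs' with rfl | h
      · rw [m1 Z φ z hM1]
        simpa using hM.1 _ _ _ (Finset.mem_insert_self _ _)
      · exact hm Z φ z (hM1.mono hR1 hE1) s' h

/-- The presented `A`-set. -/
def WR.rel (R : WR.RT A) (p q : A × ℕ) : Prop :=
  ∃ v g w, (v, g, w) ∈ R ∧ ∃ a, p = (a * g, v) ∧ q = (a, w)

def WR.X (R : WR.RT A) : Type u := Quot (WR.rel R)

def WR.mk (R : WR.RT A) (p : A × ℕ) : WR.X R := Quot.mk _ p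

instance WR.act (R : WR.RT A) : MulAction A (WR.X R) where
  smul a := Quot.map (fun p => (a * p.1, p.2)) (by
    rintro _ _ ⟨v, g, w, h, b, rfl, rfl⟩
    exact ⟨v, g, w, h, a * b, by simp [mul_assoc], rfl⟩)
  one_smul := by
    rintro ⟨p⟩
    exact congrArg (Quot.mk _) (Prod.ext (one_mul _) rfl)
  mul_smul := by
    rintro a b ⟨p⟩
    exact congrArg (Quot.mk _) (Prod.ext (mul_assoc _ _ _) rfl)

theorem WR.smul_mk (R : WR.RT A) (a : A) (p : A × ℕ) :
    a • WR.mk R p = WR.mk R (a * p.1, p.2) := rfl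

/-- The evaluation of a model on the presented set. -/
theorem WR.Model.eval {Z : Type u} {φ : WR.G A →* Equiv.Perm Z} {z : ℕ → Z} {R : WR.RT A}
    {E : WR.ET A} (h : WR.Model φ z R E) {p q : A × ℕ} (hpq : WR.mk R p = WR.mk R q) :
    φ (Monoid.Coprod.inl p.1) (z p.2) = φ (Monoid.Coprod.inl q.1) (z q.2) := by
  let F : WR.X R → Z := Quot.lift (fun p => φ (Monoid.Coprod.inl p.1) (z p.2)) (by
    rintro _ _ ⟨v, g, w, hm, a, rfl, rfl⟩
    show φ (Monoid.Coprod.inl (a * g)) (z v) = φ (Monoid.Coprod.inl a) (z w)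
    rw [map_mul, map_mul, Equiv.Perm.mul_apply, h.1 v g w hm])
  exact congrArg F hpq

def WR.Folded (R : WR.RT A) (E : WR.ET A) : Prop :=
  ∀ e ∈ E, ∀ e' ∈ E, WR.mk R e.1 = WR.mk R e'.1 ↔ WR.mk R e.2 = WR.mk R e'.2

theorem WR.fold (m : ℕ) : ∀ (R : WR.RT A) (E : WR.ET A), E.card = m →
    ∃ (R' : WR.RT A) (E' : WR.ET A), R'.card + E'.card ≤ R.card + E.card ∧ WR.Folded R' E' ∧
      ∀ (Z : Type u) (φ : WR.G A →* Equiv.Perm Z) (z : ℕ → Z), WR.Model φ z R' E' →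
        WR.Model φ z R E := by
  classical
  induction m with
  | zero =>
    intro R E hE
    rw [Finset.card_eq_zero] at hE
    subst hE
    exact ⟨R, ∅, le_rfl, by simp [WR.Folded], fun _ _ _ h => h⟩
  | succ m ih =>
    intro R E hE
    by_cases hf : WR.Folded R E
    · exact ⟨R, E, le_rfl, hf, fun _ _ _ h => h⟩
    · -- common step
      have step : ∀ (e : (A × ℕ) × (A × ℕ)) (r : ℕ × A × ℕ), e ∈ E →
          (∀ (Z : Type u) (φ : WR.G A →* Equiv.Perm Z) (z : ℕ → Z),
            WR.Model φ z (insert r R) (E.erase e) →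
            φ (WR.t A) (φ (Monoid.Coprod.inl e.1.1) (z e.1.2))
              = φ (Monoid.Coprod.inl e.2.1) (z e.2.2)) →
          ∃ (R' : WR.RT A) (E' : WR.ET A), R'.card + E'.card ≤ R.card + E.card ∧
            WR.Folded R' E' ∧
            ∀ (Z : Type u) (φ : WR.G A →* Equiv.Perm Z) (z : ℕ → Z), WR.Model φ z R' E' →
              WR.Model φ z R E := by
        intro e r he h
        have hc := Finset.card_erase_of_mem he
        obtain ⟨R', E', h1, h2, h3⟩ := ih (insert r R) (E.erase e) (by omega)
        refine ⟨R', E', ?_, h2, ?_⟩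
        · have := Finset.card_insert_le r R
          omega
        · intro Z φ z hM
          have hM' := h3 Z φ z hM
          refine ⟨fun v g w hm => hM'.1 v g w (Finset.mem_insert_of_mem hm), ?_⟩
          intro a v b w hm
          by_cases hee : ((a, v), (b, w)) = e
          · have := h Z φ z hM'
            rw [← hee] at this
            exact this
          · exact hM'.2 a v b w (Finset.mem_erase.2 ⟨hee, hm⟩)
      have hrel : ∀ (p q : A × ℕ) (Z : Type u) (φ : WR.G A →* Equiv.Perm Z) (z : ℕ → Z),
          φ (Monoid.Coprod.inl (q.1⁻¹ * p.1)) (z p.2) = z q.2 →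
          φ (Monoid.Coprod.inl p.1) (z p.2) = φ (Monoid.Coprod.inl q.1) (z q.2) := by
        intro p q Z φ z h
        rw [← h, ← Equiv.Perm.mul_apply, ← map_mul, ← map_mul, mul_inv_cancel_left]
      unfold WR.Folded at hf
      push Not at hf
      obtain ⟨e, he, e', he', hh⟩ := hf
      rcases hh with ⟨hx, hy⟩ | ⟨hx, hy⟩
      · refine step e' (e.2.2, e'.2.1⁻¹ * e.2.1, e'.2.2) he' ?_
        intro Z φ z hM
        have hne : e ≠ e' := by rintro rfl; exact hy rfl
        have hR : WR.Model φ z R (E.erase e') := hM.mono (Finset.subset_insert _ _) subset_rfl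
        rw [← hR.eval hx, hM.2 e.1.1 e.1.2 e.2.1 e.2.2 (Finset.mem_erase.2 ⟨hne, he⟩)]
        exact hrel _ _ Z φ z (hM.1 _ _ _ (Finset.mem_insert_self _ _))
      · refine step e' (e.1.2, e'.1.1⁻¹ * e.1.1, e'.1.2) he' ?_
        intro Z φ z hM
        have hne : e ≠ e' := by rintro rfl; exact hx rfl
        have hR : WR.Model φ z R (E.erase e') := hM.mono (Finset.subset_insert _ _) subset_rfl
        rw [← hR.eval hy, ← hM.2 e.1.1 e.1.2 e.2.1 e.2.2 (Finset.mem_erase.2 ⟨hne, he⟩)]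
        congr 1
        exact (hrel _ _ Z φ z (hM.1 _ _ _ (Finset.mem_insert_self _ _))).symm

theorem WR.potential (n : ℕ) (Q : WR.RT A)
    (hQ : ∀ S : Set ℕ, 0 ∈ S → (∀ v g w, (v, g, w) ∈ Q → (v ∈ S ↔ w ∈ S)) → ∀ v ≤ n, v ∈ S) :
    ∃ γ : ℕ → A, γ 0 = 1 ∧
      ∃ T : WR.RT A, T ⊆ Q ∧ n ≤ T.card ∧ ∀ q ∈ T, q.2.1 * γ q.1 = γ q.2.2 := by
  classical
  have main : ∀ m ≤ n, ∃ γ : ℕ → A, γ 0 = 1 ∧ ∃ S : Finset ℕ, 0 ∈ S ∧ S.card = m + 1 ∧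
      ∃ T : WR.RT A, T ⊆ Q ∧ m ≤ T.card ∧
        ∀ q ∈ T, q.2.1 * γ q.1 = γ q.2.2 ∧ q.1 ∈ S ∧ q.2.2 ∈ S := by
    intro m
    induction m with
    | zero => intro _; exact ⟨1, rfl, {0}, by simp, by simp, ∅, by simp, by simp, by simp⟩
    | succ m ih =>
      intro hm
      obtain ⟨γ, hγ, S, h0, hS, T, hTQ, hT, hq⟩ := ih (by omega)
      have hex : ∃ v g w, (v, g, w) ∈ Q ∧ ¬ (v ∈ S ↔ w ∈ S) := by
        by_contra hcon
        push Not at hcon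
        have := hQ S h0 (fun v g w h => by simpa using hcon v g w h)
        have hsub : Finset.range (n + 1) ⊆ S := fun v hv => by
          simpa using this v (by simpa [Nat.lt_succ_iff] using hv)
        have := Finset.card_le_card hsub
        rw [Finset.card_range] at this
        omega
      obtain ⟨v, g, w, hvw, hn⟩ := hex
      have hnT : (v, g, w) ∉ T := fun h => hn (by simp [(hq _ h).2.1, (hq _ h).2.2])
      have hcases : (v ∈ S ∧ w ∉ S) ∨ (v ∉ S ∧ w ∈ S) := by tauto
      rcases hcases with ⟨hv, hw⟩ | ⟨hv, hw⟩
      · have hne : ∀ u ∈ S, u ≠ w := fun u hu h => hw (h ▸ hu)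
        refine ⟨Function.update γ w (g * γ v), ?_, insert w S, by simp [h0], ?_,
          insert (v, g, w) T, ?_, ?_, ?_⟩
        · rw [Function.update_of_ne (hne 0 h0), hγ]
        · rw [Finset.card_insert_of_notMem hw, hS]
        · exact Finset.insert_subset hvw hTQ
        · rw [Finset.card_insert_of_notMem hnT]; omega
        · intro q hqT
          rcases Finset.mem_insert.1 hqT with rfl | h
          · simp [Function.update_of_ne (hne v hv), hv]
          · obtain ⟨a, b, c⟩ := hq q h
            rw [Function.update_of_ne (hne _ b), Function.update_of_ne (hne _ c)]
            exact ⟨a, Finset.mem_insert_of_mem b, Finset.mem_insert_of_mem c⟩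
      · have hne : ∀ u ∈ S, u ≠ v := fun u hu h => hv (h ▸ hu)
        refine ⟨Function.update γ v (g⁻¹ * γ w), ?_, insert v S, by simp [h0], ?_,
          insert (v, g, w) T, ?_, ?_, ?_⟩
        · rw [Function.update_of_ne (hne 0 h0), hγ]
        · rw [Finset.card_insert_of_notMem hv, hS]
        · exact Finset.insert_subset hvw hTQ
        · rw [Finset.card_insert_of_notMem hnT]; omega
        · intro q hqT
          rcases Finset.mem_insert.1 hqT with rfl | h
          · simp [Function.update_of_ne (hne w hw), hw]
          · obtain ⟨a, b, c⟩ := hq q h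
            rw [Function.update_of_ne (hne _ b), Function.update_of_ne (hne _ c)]
            exact ⟨a, Finset.mem_insert_of_mem b, Finset.mem_insert_of_mem c⟩
  obtain ⟨γ, hγ, S, -, -, T, h1, h2, h3⟩ := main n le_rfl
  exact ⟨γ, hγ, T, h1, h2, fun q hq => (h3 q hq).1⟩

/-- Extension of a finite partial injection without creating a fixed point. -/
theorem WR.extend {Z : Type u} [Infinite Z] (F : Finset (Z × Z))
    (hF : ∀ e ∈ F, ∀ e' ∈ F, e.1 = e'.1 ↔ e.2 = e'.2) (z₀ : Z) :
    ∃ τ : Equiv.Perm Z, (∀ e ∈ F, τ e.1 = e.2) ∧ (τ z₀ = z₀ → (z₀, z₀) ∈ F) := by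
  classical
  have ext : ∀ (F : Finset (Z × Z)), (∀ e ∈ F, ∀ e' ∈ F, e.1 = e'.1 ↔ e.2 = e'.2) →
      ∃ τ : Equiv.Perm Z, (∀ e ∈ F, τ e.1 = e.2) := by
    intro F hF
    let s : Set Z := (F.image Prod.fst : Finset Z)
    have hs : ∀ x : s, ∃ e ∈ F, e.1 = x.1 := fun x => by simpa [s] using x.2
    choose c hc hc' using hs
    let f : s ↪ Z := ⟨fun x => (c x).2, fun x y h =>
      Subtype.ext (by rw [← hc' x, ← hc' y]; exact (hF _ (hc x) _ (hc y)).2 h)⟩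
    obtain ⟨g, hg⟩ := Cardinal.extend_function_of_lt f
      ((Cardinal.lt_aleph0_of_finite s).trans_le (Cardinal.aleph0_le_mk Z)) ⟨Equiv.refl _⟩
    refine ⟨g, fun e he => ?_⟩
    have hes : e.1 ∈ s := by
      simp only [s, Finset.coe_image]; exact ⟨e, he, rfl⟩
    rw [show e.1 = ((⟨e.1, hes⟩ : s) : Z) from rfl, hg]
    exact (hF _ (hc _) _ he).1 (hc' _)
  by_cases h : ∃ e ∈ F, e.1 = z₀
  · obtain ⟨τ, hτ⟩ := ext F hF
    refine ⟨τ, hτ, fun h0 => ?_⟩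
    obtain ⟨e, he, rfl⟩ := h
    have := hτ e he
    rw [h0] at this
    have h2 : (e.1, e.1) = e := Prod.ext rfl this
    rw [h2]; exact he
  · push Not at h
    obtain ⟨y, hy⟩ := Infinite.exists_notMem_finset (insert z₀ (F.image Prod.snd))
    simp only [Finset.mem_insert, Finset.mem_image, not_or, not_exists, not_and] at hy
    obtain ⟨τ, hτ⟩ := ext (insert (z₀, y) F) (by
      intro e he e' he'
      rcases Finset.mem_insert.1 he with rfl | he <;> rcases Finset.mem_insert.1 he' with rfl | he'
      · simp
      · exact ⟨fun h' => absurd h'.symm (h _ he'), fun h' => absurd h'.symm (hy.2 _ he')⟩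
      · exact ⟨fun h' => absurd h' (h _ he), fun h' => absurd h' (hy.2 _ he)⟩
      · exact hF e he e' he')
    refine ⟨τ, fun e he => hτ e (Finset.mem_insert_of_mem he), fun h0 => ?_⟩
    have := hτ (z₀, y) (Finset.mem_insert_self _ _)
    exact absurd (this.symm.trans h0) hy.1

theorem WR.key (S : Finset (WR.G A)) (ht : WR.t A ∈ Subgroup.closure (S : Set (WR.G A))) :
    ∃ T : Finset A, T.card + 1 ≤ S.card ∧
      (Subgroup.closure (S : Set (WR.G A))).comap Monoid.Coprod.inl
        ≤ Subgroup.closure (T : Set A) := by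
  classical
  obtain ⟨n, R0, E0, ⟨hc0, hconn⟩, hfix⟩ := WR.init S
  obtain ⟨R, E, hc, hfold, hmod⟩ := WR.fold _ R0 E0 rfl
  -- the model
  let Z := WR.X R × ULift.{u} ℕ
  let ι : WR.X R → Z := fun x => (x, ⟨0⟩)
  have hι : Function.Injective ι := fun x y h => congrArg Prod.fst h
  have : Nonempty (WR.X R) := ⟨WR.mk R (1, 0)⟩
  let x0 : WR.X R := WR.mk R (1, 0)
  let actZ : A →* Equiv.Perm Z :=
    { toFun := fun a => Equiv.prodCongr (MulAction.toPerm a) (Equiv.refl _)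
      map_one' := by ext ⟨p, q⟩ <;> simp
      map_mul' := by intro a b; ext ⟨p, q⟩ <;> simp [mul_smul] }
  have hact : ∀ a x, actZ a (ι x) = ι (a • x) := fun a x => rfl
  let F : Finset (Z × Z) := E.image (fun e => (ι (WR.mk R e.1), ι (WR.mk R e.2)))
  obtain ⟨τ, hτ, hτ0⟩ := WR.extend F (by
    intro e he e' he'
    obtain ⟨d, hd, rfl⟩ := Finset.mem_image.1 he
    obtain ⟨d', hd', rfl⟩ := Finset.mem_image.1 he'
    simp only [hι.eq_iff]
    exact hfold d hd d' hd') (ι x0)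
  let φ : WR.G A →* Equiv.Perm Z := Monoid.Coprod.lift actZ (zpowersHom _ τ)
  have hφa : ∀ a, φ (Monoid.Coprod.inl a) = actZ a := fun a => Monoid.Coprod.lift_apply_inl _ _ _
  have hφt : φ (WR.t A) = τ := by simp [φ, WR.t]
  let z : ℕ → Z := fun v => ι (WR.mk R (1, v))
  have hM : WR.Model φ z R E := by
    constructor
    · intro v g w h
      rw [hφa, hact, WR.smul_mk]
      congr 1
      exact Quot.sound ⟨v, g, w, h, 1, by simp, rfl⟩
    · intro a v b w h
      rw [hφa, hφt, hφa, hact, hact, WR.smul_mk, WR.smul_mk]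
      simp only [mul_one]
      exact hτ (ι (WR.mk R (a, v)), ι (WR.mk R (b, w))) (Finset.mem_image_of_mem _ h)
  have hfixC : ∀ c ∈ Subgroup.closure (S : Set (WR.G A)), φ c (ι x0) = ι x0 := by
    let K : Subgroup (WR.G A) := (MulAction.stabilizer (Equiv.Perm Z) (ι x0)).comap φ
    have : Subgroup.closure (S : Set (WR.G A)) ≤ K := by
      rw [Subgroup.closure_le]
      exact fun s hs => hfix Z φ z (hmod Z φ z hM) s hs
    exact fun c hc => this hc
  have hloop := hτ0 (by rw [← hφt]; exact hfixC _ ht)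
  obtain ⟨e0, he0, he0'⟩ := Finset.mem_image.1 hloop
  have hx0 : WR.mk R e0.1 = x0 := hι (congrArg Prod.fst he0')
  have hy0 : WR.mk R e0.2 = x0 := hι (congrArg Prod.snd he0')
  let Q : WR.RT A := R ∪ (E.erase e0).image (fun e => (e.1.2, e.2.1⁻¹ * e.1.1, e.2.2))
  have hQc : Q.card + 1 ≤ n + S.card := by
    have h1 := Finset.card_union_le R
      ((E.erase e0).image (fun e => (e.1.2, e.2.1⁻¹ * e.1.1, e.2.2)))
    have h2 := Finset.card_image_le (s := E.erase e0)
      (f := fun e => (e.1.2, e.2.1⁻¹ * e.1.1, e.2.2))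
    have h3 := Finset.card_erase_add_one he0
    show (R ∪ _).card + 1 ≤ _
    omega
  obtain ⟨γ, hγ, T, hTQ, hTn, hT⟩ := WR.potential n Q (by
    intro U h0 hU v hv
    let z' : ℕ → ULift.{u} Prop := fun v => ⟨v ∈ U⟩
    have hRE : WR.Model (1 : WR.G A →* Equiv.Perm (ULift.{u} Prop)) z' R ∅ := by
      constructor
      · intro v g w h
        have := hU v g w (Finset.mem_union_left _ h)
        exact ULift.ext _ _ (propext this)
      · intro a v b w h
        exact absurd h (Finset.notMem_empty _)
    have hm : WR.Model (1 : WR.G A →* Equiv.Perm (ULift.{u} Prop)) z' R E := by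
      refine ⟨hRE.1, ?_⟩
      intro a v b w h
      by_cases hee : ((a, v), (b, w)) = e0
      · subst hee
        exact hRE.eval (hx0.trans hy0.symm)
      · have := hU v (b⁻¹ * a) w (Finset.mem_union_right _
          (Finset.mem_image.2 ⟨((a, v), (b, w)), Finset.mem_erase.2 ⟨hee, h⟩, rfl⟩))
        exact ULift.ext _ _ (propext this)
    have := hconn _ z' (hmod _ _ _ hm) v hv
    have h' : (v ∈ U) = (0 ∈ U) := congrArg ULift.down this
    rw [h']; exact h0)
  let D : Finset A := (R \ T).image (fun q => (γ q.2.2)⁻¹ * (q.2.1 * γ q.1))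
  refine ⟨D, ?_, ?_⟩
  · have h1 : D.card ≤ (R \ T).card := Finset.card_image_le
    have h2 : (R \ T).card ≤ (Q \ T).card :=
      Finset.card_le_card (Finset.sdiff_subset_sdiff Finset.subset_union_left subset_rfl)
    have h3 := Finset.card_sdiff_add_card_eq_card hTQ
    omega
  · intro a ha
    have h1 : a • x0 = x0 := by
      have := hfixC _ ha
      rw [hφa, hact] at this
      exact hι this
    let DD := Subgroup.closure (D : Set A)
    let Φ : WR.X R → A ⧸ DD := Quot.lift (fun p => ((p.1 * γ p.2 : A) : A ⧸ DD)) (by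
      rintro _ _ ⟨v, g, w, hm, b, rfl, rfl⟩
      refine Eq.symm (QuotientGroup.eq.2 ?_)
      have e1 : (b * γ w)⁻¹ * (b * g * γ v) = (γ w)⁻¹ * (g * γ v) := by group
      show (b * γ w)⁻¹ * (b * g * γ v) ∈ DD
      rw [e1]
      by_cases hmT : (v, g, w) ∈ T
      · have := hT _ hmT
        simp only at this
        rw [this, inv_mul_cancel]
        exact one_mem _
      · exact Subgroup.subset_closure (Finset.mem_coe.2 (Finset.mem_image.2
          ⟨(v, g, w), Finset.mem_sdiff.2 ⟨hm, hmT⟩, rfl⟩)))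
    have h2 : (((a * 1) * γ 0 : A) : A ⧸ DD) = ((1 * γ 0 : A) : A ⧸ DD) := congrArg Φ h1
    rw [hγ] at h2
    have := QuotientGroup.eq.1 h2.symm
    simpa using this

end Fold

theorem WR.part1 {Γ : Type u} [Group Γ] (A : Subgroup Γ) (x : Γ) (hA : localRank A < ⊤)
    (hinj : Function.Injective (iotaAX A x)) :
    localRank A < localRank (A ⊔ Subgroup.closure {x}) := by
  classical
  obtain ⟨r, hr⟩ : ∃ r : ℕ, localRank A = r := ⟨_, (ENat.natCast_toNat hA.ne).symm⟩
  by_contra hcon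
  rw [not_lt, hr, WR.localRank_le_iff] at hcon
  have hιt : iotaAX A x (WR.t A) = x := by simp [iotaAX, WR.t]
  have hιa : ∀ a : A, iotaAX A x (Monoid.Coprod.inl a) = a := fun a => by simp [iotaAX]
  have hrange : (iotaAX A x).range = A ⊔ Subgroup.closure {x} := by
    rw [MonoidHom.range_eq_map, ← WR.range_sup, Subgroup.map_sup, MonoidHom.map_closure,
      Set.image_singleton]
    congr 1
    · ext y
      constructor
      · rintro ⟨_, ⟨a, rfl⟩, rfl⟩
        rw [hιa]; exact a.2
      · intro hy
        exact ⟨_, ⟨⟨y, hy⟩, rfl⟩, hιa _⟩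
    · exact congrArg (fun y => Subgroup.closure {y}) hιt
  have key : ∀ B : Subgroup Γ, B ≤ A → B.FG → 1 ≤ r ∧
      ∃ C : Subgroup Γ, C ≤ A ∧ B ≤ C ∧ subgroupRank C ≤ ((r - 1 : ℕ) : ℕ∞) := by
    intro B hB hBfg
    obtain ⟨C', hC', hBC', hCr⟩ := hcon (B ⊔ Subgroup.closure {x}) (sup_le_sup_right hB _)
      (hBfg.sup ⟨{x}, by simp⟩)
    obtain ⟨S', hS', hSr⟩ := (WR.rank_le_iff C' r).1 hCr
    obtain ⟨S, hS, hSc⟩ : ∃ S : Finset (WR.G A), S.image (iotaAX A x) = S' ∧ S.card ≤ S'.card := by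
      have : (S' : Set Γ) ⊆ Set.range (iotaAX A x) := by
        intro s hs
        have : s ∈ (iotaAX A x).range := by
          rw [hrange]; exact hC' (hS' ▸ Subgroup.subset_closure hs)
        exact this
      refine ⟨S'.preimage (iotaAX A x) hinj.injOn, ?_, ?_⟩
      · rw [Finset.image_preimage]
        refine Finset.filter_true_of_mem fun s hs => this hs
      · exact Finset.card_le_card_of_injOn (iotaAX A x)
          (fun s hs => by simpa using hs) hinj.injOn
    have hmap : (Subgroup.closure (S : Set (WR.G A))).map (iotaAX A x) = C' := by
      rw [MonoidHom.map_closure, ← hS', ← hS, Finset.coe_image]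
    have hmem : ∀ w, iotaAX A x w ∈ C' → w ∈ Subgroup.closure (S : Set (WR.G A)) := by
      intro w hw
      rw [← hmap] at hw
      obtain ⟨w', hw', h⟩ := hw
      rw [← hinj h]; exact hw'
    obtain ⟨T, hTc, hT⟩ := WR.key S (hmem _ (by
      rw [hιt]; exact hBC' (Subgroup.mem_sup_right (Subgroup.subset_closure rfl))))
    refine ⟨by omega, (Subgroup.closure (T : Set A)).map A.subtype, ?_, ?_, ?_⟩
    · rintro _ ⟨a, _, rfl⟩; exact a.2
    · intro b hb
      refine ⟨⟨b, hB hb⟩, hT (hmem _ ?_), rfl⟩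
      rw [hιa]; exact hBC' (Subgroup.mem_sup_left hb)
    · rw [WR.rank_le_iff]
      refine ⟨T.image A.subtype, ?_, ?_⟩
      · rw [MonoidHom.map_closure, Finset.coe_image]
      · have : (T.image A.subtype).card ≤ T.card := Finset.card_image_le
        omega
  have h1 : 1 ≤ r := (key ⊥ bot_le ⟨∅, by simp⟩).1
  have h2 : LocalRankLE A (r - 1) := fun B hB hf => (key B hB hf).2
  have h3 := (WR.localRank_le_iff A (r - 1)).2 h2
  rw [hr] at h3
  have : r ≤ r - 1 := by exact_mod_cast h3
  omega

/-- If `localRank A < ∞` and `ι_{A,x}` is injective, then `localRank ⟨A,x⟩ > localRank A`.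
Conversely, if `A` is strongly closable and `localRank ⟨A,x⟩ > localRank A`, then `ι_{A,x}`
is injective. -/
theorem when_the_rank_goes_up {Γ : Type*} [Group Γ] (A : Subgroup Γ) (x : Γ) :
    (localRank A < ⊤ → Function.Injective (iotaAX A x) →
      localRank A < localRank (A ⊔ Subgroup.closure {x})) ∧
    (StronglyClosable A → localRank A < localRank (A ⊔ Subgroup.closure {x}) →
      Function.Injective (iotaAX A x)) := by
  exact ⟨WR.part1 A x, WR.part2 A x⟩
end

section
/- Let A and B be subgroups of a group Γ. Suppose that B ≤ A, that localrank(B) < ∞, and that A is strongly closable. Then every B-admissible element of Γ is A-admissible. -/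
theorem aux_rank_gen {Γ : Type*} [Group Γ] {H : Subgroup Γ} {n : ℕ}
    (h : subgroupRank H ≤ (n : ℕ∞)) : ∃ g : Fin n → Γ, Subgroup.closure (Set.range g) = H := by
  have h2 : ∃ S : Finset Γ, Subgroup.closure (S : Set Γ) = H ∧ S.card ≤ n := by
    by_contra hc
    push Not at hc
    have : ((n + 1 : ℕ) : ℕ∞) ≤ subgroupRank H := by
      unfold subgroupRank
      refine le_iInf₂ fun S hS => ?_
      exact_mod_cast hc S hS
    have h3 := this.trans h
    norm_cast at h3
    omega
  obtain ⟨S, hS, hn⟩ := h2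
  refine ⟨fun i => if hi : (i : ℕ) < S.card then (S.equivFin.symm ⟨i, hi⟩ : Γ) else 1, ?_⟩
  rw [← hS]
  apply le_antisymm
  · rw [Subgroup.closure_le]
    rintro _ ⟨i, rfl⟩
    dsimp only
    split_ifs with hi
    · exact Subgroup.subset_closure (S.equivFin.symm ⟨i, hi⟩).2
    · exact one_mem _
  · apply Subgroup.closure_mono
    intro s hs
    refine ⟨⟨S.equivFin ⟨s, hs⟩, lt_of_lt_of_le (S.equivFin ⟨s, hs⟩).2 hn⟩, ?_⟩
    simp

theorem aux_gen_rank {Γ : Type*} [Group Γ] {ι : Type*} [Finite ι] {H : Subgroup Γ}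
    (g : ι → Γ) (h : Subgroup.closure (Set.range g) = H) :
    subgroupRank H ≤ ((Nat.card ι : ℕ) : ℕ∞) := by
  classical
  have := Fintype.ofFinite ι
  refine (iInf₂_le (Finset.univ.image g) (by simpa using h)).trans ?_
  rw [Nat.card_eq_fintype_card]
  exact_mod_cast Finset.card_image_le

theorem aux_localRankLE {Γ : Type*} [Group Γ] {A : Subgroup Γ} {n : ℕ}
    (h : localRank A ≤ (n : ℕ∞)) : LocalRankLE A n := by
  have h2 : ∃ r, LocalRankLE A r ∧ r ≤ n := by
    by_contra hc
    push Not at hc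
    have : ((n + 1 : ℕ) : ℕ∞) ≤ localRank A := by
      unfold localRank
      refine le_iInf₂ fun S hS => ?_
      exact_mod_cast hc S hS
    have h3 := this.trans h
    norm_cast at h3
    omega
  obtain ⟨r, hr, hn⟩ := h2
  intro B hB hfg
  obtain ⟨C, h1, h2, h3⟩ := hr B hB hfg
  exact ⟨C, h1, h2, h3.trans (by exact_mod_cast hn)⟩

theorem aux_localRank_le {Γ : Type*} [Group Γ] {A : Subgroup Γ} {n : ℕ}
    (h : LocalRankLE A n) : localRank A ≤ (n : ℕ∞) := iInf₂_le n h

theorem aux_kfree {Γ : Type*} [Group Γ] {n : ℕ} (h : (n : ℕ∞) < iof Γ) : KFree Γ (n + 1) := by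
  unfold iof at h
  simp only [lt_iSup_iff] at h
  obtain ⟨k, hk, hn⟩ := h
  intro H hH
  refine hk H (hH.trans ?_)
  norm_cast at hn ⊢

/-- Free groups are residually finite. -/
theorem aux_resfin {α : Type*} (w : FreeGroup α) (hw : w ≠ 1) :
    ∃ (S : Finset (FreeGroup α)) (φ : FreeGroup α →* Equiv.Perm S), φ w ≠ 1 := by
  classical
  obtain ⟨L, rfl⟩ : ∃ L, FreeGroup.mk L = w := ⟨w.toWord, FreeGroup.mk_toWord⟩
  let S : Finset (FreeGroup α) := (L.tails.map FreeGroup.mk).toFinset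
  have hS : ∀ l, l <:+ L → FreeGroup.mk l ∈ S := fun l hl => by
    simp only [S, List.mem_toFinset, List.mem_map, List.mem_tails]
    exact ⟨l, hl, rfl⟩
  have hσ : ∀ a : α, ∃ σ : Equiv.Perm S, ∀ s : S, ∀ hs : FreeGroup.of a * s ∈ S,
      σ s = ⟨FreeGroup.of a * s, hs⟩ := by
    intro a
    let p : S → Prop := fun s => FreeGroup.of a * s ∈ S
    let q : S → Prop := fun s => (FreeGroup.of a)⁻¹ * s ∈ S
    let e : {s // p s} ≃ {s // q s} :=
      { toFun := fun s => ⟨⟨_, s.2⟩, by simp [q]⟩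
        invFun := fun s => ⟨⟨_, s.2⟩, by simp [p]⟩
        left_inv := fun s => by ext; simp
        right_inv := fun s => by ext; simp }
    refine ⟨e.extendSubtype, fun s hs => ?_⟩
    rw [Equiv.extendSubtype_apply_of_mem e s hs]
    rfl
  choose σ hσ using hσ
  refine ⟨S, FreeGroup.lift σ, fun h => ?_⟩
  have key : ∀ l, ∀ hl : l <:+ L,
      FreeGroup.lift σ (FreeGroup.mk l) ⟨1, hS [] (List.nil_suffix)⟩ = ⟨FreeGroup.mk l, hS l hl⟩ := by
    intro l
    induction l with
    | nil => intro hl; simp [← FreeGroup.one_eq_mk]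
    | cons x l ih =>
      intro hl
      have hl' : l <:+ L := (List.suffix_cons x l).trans hl
      have e1 : FreeGroup.mk (x :: l) = FreeGroup.mk [x] * FreeGroup.mk l := by simp
      have hm := hS _ hl
      rw [e1] at hm
      have goal' : FreeGroup.lift σ (FreeGroup.mk [x]) ⟨FreeGroup.mk l, hS l hl'⟩
          = ⟨FreeGroup.mk [x] * FreeGroup.mk l, hm⟩ := by
        obtain ⟨a, b⟩ := x
        cases b
        · have e2 : FreeGroup.mk [(a, false)] = (FreeGroup.of a)⁻¹ := by
            simp [FreeGroup.of, FreeGroup.invRev]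
          simp only [e2] at hm ⊢
          rw [map_inv, FreeGroup.lift_apply_of, Equiv.Perm.inv_eq_iff_eq, hσ a _ (by simpa using hS l hl')]
          simp
        · have e2 : FreeGroup.mk [(a, true)] = FreeGroup.of a := rfl
          simp only [e2] at hm ⊢
          rw [FreeGroup.lift_apply_of, hσ a _ hm]
      simp only [e1, map_mul, Equiv.Perm.mul_apply, ih hl', goal']
  have := key L List.suffix_rfl
  rw [h] at this
  exact hw (congrArg Subtype.val this).symm

theorem aux_hopf {X : Type*} {m : ℕ} (f : FreeGroup (Fin m) →* FreeGroup X)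
    (hf : Function.Surjective f) (hni : ¬ Function.Injective f) : Finite X ∧ Nat.card X < m := by
  classical
  rw [injective_iff_map_eq_one] at hni
  push Not at hni
  obtain ⟨w, hw, hw1⟩ := hni
  obtain ⟨S, φ, hφ⟩ := aux_resfin w hw1
  let Q := Equiv.Perm S
  have : Nontrivial Q := ⟨⟨_, _, hφ⟩⟩
  let F : (X → Q) → (Fin m → Q) := fun u => FreeGroup.lift.symm ((FreeGroup.lift u).comp f)
  have hF : Function.Injective F := by
    intro u v huv
    have := FreeGroup.lift.symm.injective huv
    rw [MonoidHom.cancel_right hf] at this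
    exact FreeGroup.lift.injective this
  have hFs : ¬ Function.Surjective F := by
    intro hs
    obtain ⟨u, hu⟩ := hs (FreeGroup.lift.symm φ)
    have := FreeGroup.lift.symm.injective hu
    apply hφ
    rw [← this]
    simp [hw]
  have hfin : Finite (X → Q) := Finite.of_injective F hF
  obtain ⟨q, hq⟩ := exists_ne (1 : Q)
  have hX : Finite X := by
    refine Finite.of_injective (fun x : X => (Pi.mulSingle x q : X → Q)) ?_
    intro x y hxy
    by_contra hne
    have := congrFun hxy x
    simp [hne] at this
    exact hq this
  refine ⟨hX, ?_⟩
  have hlt : Nat.card (X → Q) < Nat.card (Fin m → Q) := by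
    by_contra hc
    have := hF.bijective_of_nat_card_le (not_lt.mp hc)
    exact hFs this.2
  rw [Nat.card_fun, Nat.card_fun, Nat.card_fin] at hlt
  exact (Nat.pow_lt_pow_iff_right Finite.one_lt_card).mp hlt

theorem aux_rank_lt {Γ : Type*} [Group Γ] {m : ℕ} (g : Fin m → Γ)
    (hfree : IsFreeGroup (Subgroup.closure (Set.range g))) (w : FreeGroup (Fin m)) (hw : w ≠ 1)
    (hgw : FreeGroup.lift g w = 1) :
    ∃ k : ℕ, k < m ∧ subgroupRank (Subgroup.closure (Set.range g)) ≤ (k : ℕ∞) := by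
  set E := Subgroup.closure (Set.range g) with hE
  let g' : Fin m → E := fun i => ⟨g i, Subgroup.subset_closure ⟨i, rfl⟩⟩
  have hcomp : E.subtype.comp (FreeGroup.lift g') = FreeGroup.lift g := by
    ext; simp [g']
  let e := IsFreeGroup.toFreeGroup E
  let f : FreeGroup (Fin m) →* FreeGroup (IsFreeGroup.Generators E) :=
    e.toMonoidHom.comp (FreeGroup.lift g')
  have hs : Function.Surjective (FreeGroup.lift g') := by
    rintro ⟨y, hy⟩
    rw [hE, ← FreeGroup.range_lift_eq_closure] at hy
    obtain ⟨z, hz⟩ := hy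
    refine ⟨z, Subtype.ext ?_⟩
    rw [← hcomp] at hz
    exact hz
  obtain ⟨h1, h2⟩ := aux_hopf f (e.surjective.comp hs) (fun hi => hw (hi (by
    have : FreeGroup.lift g' w = 1 := by
      apply Subtype.ext
      rw [← hcomp] at hgw
      exact hgw
    simp [f, this])))
  refine ⟨_, h2, aux_gen_rank (fun x => ((IsFreeGroup.of x : E) : Γ)) ?_⟩
  have h3 : Subgroup.closure (Set.range (IsFreeGroup.of (G := E))) = ⊤ := by
    have := FreeGroup.closure_range_of (IsFreeGroup.Generators E)
    have h4 := congrArg (Subgroup.map e.symm.toMonoidHom) this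
    rw [MonoidHom.map_closure, ← Set.range_comp, Subgroup.map_top_of_surjective _ e.symm.surjective] at h4
    exact h4
  have h5 := congrArg (Subgroup.map E.subtype) h3
  rw [MonoidHom.map_closure, ← Set.range_comp, ← MonoidHom.range_eq_map, Subgroup.range_subtype] at h5
  exact h5

/-- Every finite subset of `A ∗ ℤ` involves only finitely many elements of `A`. -/
theorem aux_finite_coeff {G : Type*} [Group G] (T : Set (Monoid.Coprod G (Multiplicative ℤ)))
    (hT : T.Finite) : ∃ S : Set G, S.Finite ∧ T ⊆ Subgroup.closure
      (Monoid.Coprod.inl '' S ∪ {Monoid.Coprod.inr (Multiplicative.ofAdd (1 : ℤ))}) := by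
  have h1 : ∀ w : Monoid.Coprod G (Multiplicative ℤ), ∃ S : Set G, S.Finite ∧ w ∈ Subgroup.closure
      (Monoid.Coprod.inl '' S ∪ {Monoid.Coprod.inr (Multiplicative.ofAdd (1 : ℤ))}) := by
    intro w
    induction w using Monoid.Coprod.induction_on with
    | inl g => exact ⟨{g}, Set.finite_singleton g, Subgroup.subset_closure (by simp)⟩
    | inr n =>
      refine ⟨∅, Set.finite_empty, ?_⟩
      have : n = (Multiplicative.ofAdd (1 : ℤ)) ^ (Multiplicative.toAdd n) := by
        rw [← ofAdd_zsmul]; simp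
      rw [this, map_zpow]
      exact Subgroup.zpow_mem _ (Subgroup.subset_closure (by simp)) _
    | mul x y hx hy =>
      obtain ⟨S, hS, hx⟩ := hx
      obtain ⟨S', hS', hy⟩ := hy
      refine ⟨S ∪ S', hS.union hS', mul_mem ?_ ?_⟩
      · exact Subgroup.closure_mono
          (Set.union_subset_union_left _ (Set.image_mono Set.subset_union_left)) hx
      · exact Subgroup.closure_mono
          (Set.union_subset_union_left _ (Set.image_mono Set.subset_union_right)) hy
  choose S hS hw using h1
  refine ⟨⋃ w ∈ T, S w, hT.biUnion fun w _ => hS w, fun w hwT => ?_⟩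
  exact Subgroup.closure_mono
    (Set.union_subset_union_left _ (Set.image_mono (Set.subset_biUnion_of_mem hwT))) (hw w)

theorem aux_range_iota {Γ : Type*} [Group Γ] (A : Subgroup Γ) (x : Γ) :
    (iotaAX A x).range = A ⊔ Subgroup.closure {x} := by
  unfold iotaAX
  rw [Monoid.Coprod.range_lift, Subgroup.range_subtype, ← Subgroup.zpowers_eq_closure]
  congr 1

/-- If `ι_{A,x}` is not injective, local rank does not go up. -/
theorem aux_part1 {Γ : Type*} [Group Γ] (A : Subgroup Γ) (x : Γ) (r : ℕ)
    (hr : LocalRankLE A r) (hk : KFree Γ (r + 1))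
    (hni : ¬ Function.Injective (iotaAX A x)) :
    LocalRankLE (A ⊔ Subgroup.closure {x}) r := by
  classical
  rw [injective_iff_map_eq_one] at hni
  push Not at hni
  obtain ⟨w, hw, hw1⟩ := hni
  intro H hH hfg
  obtain ⟨T, hT⟩ := hfg
  have hpre : ∀ t : T, ∃ u, iotaAX A x u = t := by
    rintro ⟨t, ht⟩
    have : t ∈ (iotaAX A x).range := by
      rw [aux_range_iota]
      exact hH (hT ▸ Subgroup.subset_closure ht)
    exact this
  choose u hu using hpre
  obtain ⟨S, hS, hTS⟩ := aux_finite_coeff (insert w (Set.range u))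
    ((Set.finite_range u).insert w)
  obtain ⟨A0, hA0, hS0, hrk⟩ := hr (Subgroup.closure (Subtype.val '' S))
    (by rw [Subgroup.closure_le]; rintro _ ⟨a, _, rfl⟩; exact a.2)
    ⟨(hS.image Subtype.val).toFinset, by simp⟩
  obtain ⟨g, hg⟩ := aux_rank_gen hrk
  have hgA : ∀ i, g i ∈ A := fun i => hA0 (hg ▸ Subgroup.subset_closure ⟨i, rfl⟩)
  let g1 : Fin r → A := fun i => ⟨g i, hgA i⟩
  let G : Fin (r + 1) → Monoid.Coprod A (Multiplicative ℤ) :=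
    Fin.snoc (α := fun _ => Monoid.Coprod A (Multiplicative ℤ))
      (fun i => Monoid.Coprod.inl (g1 i)) (Monoid.Coprod.inr (Multiplicative.ofAdd (1 : ℤ)))
  have hg1 : Subgroup.map A.subtype (Subgroup.closure (Set.range g1)) = A0 := by
    rw [MonoidHom.map_closure, ← Set.range_comp, ← hg]
    rfl
  have hG : Subgroup.closure
      (Monoid.Coprod.inl '' S ∪ {Monoid.Coprod.inr (Multiplicative.ofAdd (1 : ℤ))}) ≤
      Subgroup.closure (Set.range G) := by
    rw [Subgroup.closure_le]
    rintro _ (⟨a, ha, rfl⟩ | rfl)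
    · have h1 : (a : Γ) ∈ A0 := hS0 (Subgroup.subset_closure ⟨a, ha, rfl⟩)
      rw [← hg1] at h1
      obtain ⟨b, hb, hba⟩ := h1
      have hab : b = a := Subtype.ext hba
      subst hab
      have h2 : Monoid.Coprod.inl b ∈ Subgroup.map
          (Monoid.Coprod.inl : A →* Monoid.Coprod A (Multiplicative ℤ))
          (Subgroup.closure (Set.range g1)) := ⟨b, hb, rfl⟩
      rw [MonoidHom.map_closure] at h2
      refine Subgroup.closure_mono ?_ h2
      rintro _ ⟨_, ⟨i, rfl⟩, rfl⟩
      exact ⟨i.castSucc, by simp [G]⟩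
    · exact Subgroup.subset_closure ⟨Fin.last r, by simp [G]⟩
  have hrange := FreeGroup.range_lift_eq_closure (f := G)
  have hTG : ∀ v ∈ insert w (Set.range u), ∃ z, FreeGroup.lift G z = v := by
    intro v hv
    have := hG (hTS hv)
    rw [← hrange] at this
    exact this
  obtain ⟨z, hz⟩ := hTG w (Set.mem_insert _ _)
  let γ : Fin (r + 1) → Γ := fun i => iotaAX A x (G i)
  have hγ : FreeGroup.lift γ = (iotaAX A x).comp (FreeGroup.lift G) := by
    ext; simp [γ]
  have hE := FreeGroup.range_lift_eq_closure (f := γ)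
  have hfree : IsFreeGroup (Subgroup.closure (Set.range γ)) :=
    hk _ ((aux_gen_rank γ rfl).trans (by simp))
  obtain ⟨k, hkr, hrank⟩ := aux_rank_lt γ hfree z
    (by rintro rfl; exact hw1 (by rw [← hz, map_one])) (by rw [hγ, MonoidHom.comp_apply, hz, hw])
  refine ⟨_, ?_, ?_, hrank.trans (by exact_mod_cast Nat.lt_succ_iff.mp hkr)⟩
  · rw [Subgroup.closure_le, ← aux_range_iota]
    rintro _ ⟨i, rfl⟩
    exact ⟨_, rfl⟩
  · rw [← hT, Subgroup.closure_le, ← hE]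
    intro t ht
    obtain ⟨y, hy⟩ := hTG (u ⟨t, ht⟩) (Set.mem_insert_of_mem _ ⟨_, rfl⟩)
    refine ⟨y, ?_⟩
    rw [hγ, MonoidHom.comp_apply, hy, hu]

/-- If `ι_{A,x}` is injective and `B ≤ A`, then adjoining `x` raises the local rank of `B`. -/
theorem aux_part2 {Γ : Type*} [Group Γ] (A B : Subgroup Γ) (hBA : B ≤ A) (x : Γ) (m : ℕ)
    (hm : LocalRankLE (B ⊔ Subgroup.closure {x}) m) (hk : KFree Γ m)
    (hi : Function.Injective (iotaAX A x)) :
    ∃ k < m, LocalRankLE B k := by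
  classical
  have hx1 : x ≠ 1 := by
    intro hx
    have h1 : iotaAX A x (Monoid.Coprod.inr (Multiplicative.ofAdd (1 : ℤ))) = 1 := by
      simp [iotaAX, hx]
    have h2 := Monoid.Coprod.inr_injective (hi (h1.trans (map_one _).symm) |>.trans (map_one Monoid.Coprod.inr).symm)
    exact one_ne_zero (Multiplicative.ofAdd.injective h2)
  -- the retraction
  let e := MonoidHom.ofInjective hi
  let ρ : (iotaAX A x).range →* Γ :=
    A.subtype.comp (Monoid.Coprod.fst.comp e.symm.toMonoidHom)
  have hρ : ∀ v, ρ (e v) = (Monoid.Coprod.fst v : A) := fun v => by simp [ρ]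
  have hρA : ∀ (a : Γ) (ha : a ∈ A) (h : a ∈ (iotaAX A x).range), ρ ⟨a, h⟩ = a := by
    intro a ha h
    have : (⟨a, h⟩ : (iotaAX A x).range) = e (Monoid.Coprod.inl ⟨a, ha⟩) :=
      Subtype.ext (by rw [MonoidHom.ofInjective_apply]; simp [iotaAX])
    rw [this, hρ]; simp
  have hρx : ∀ h : x ∈ (iotaAX A x).range, ρ ⟨x, h⟩ = 1 := by
    intro h
    have : (⟨x, h⟩ : (iotaAX A x).range) = e (Monoid.Coprod.inr (Multiplicative.ofAdd (1 : ℤ))) :=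
      Subtype.ext (by rw [MonoidHom.ofInjective_apply]; simp [iotaAX])
    rw [this, hρ]; simp
  have hCR : B ⊔ Subgroup.closure {x} ≤ (iotaAX A x).range := by
    rw [aux_range_iota]; exact sup_le_sup_right hBA _
  have hρC : ∀ c (hc : c ∈ B ⊔ Subgroup.closure {x}), ρ ⟨c, hCR hc⟩ ∈ B := by
    have : B ⊔ Subgroup.closure {x} ≤ Subgroup.map (iotaAX A x).range.subtype (B.comap ρ) := by
      refine sup_le ?_ ?_
      · intro b hb
        have hb' := hCR ((le_sup_left : B ≤ B ⊔ Subgroup.closure {x}) hb)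
        exact ⟨⟨b, hb'⟩, by simpa [hρA b (hBA hb) hb'] using hb, rfl⟩
      · rw [Subgroup.closure_le, Set.singleton_subset_iff]
        have hx' := hCR ((le_sup_right : _ ≤ B ⊔ Subgroup.closure {x})
          (Subgroup.subset_closure (Set.mem_singleton x)))
        exact ⟨⟨x, hx'⟩, by simp [hρx hx'], rfl⟩
    intro c hc
    obtain ⟨⟨c', hc'⟩, h1, h2⟩ := this hc
    have : c' = c := h2
    subst this
    exact h1
  have main : ∀ B0 : Subgroup Γ, B0 ≤ B → B0.FG →
      ∃ k < m, ∃ E : Subgroup Γ, E ≤ B ∧ B0 ≤ E ∧ subgroupRank E ≤ (k : ℕ∞) := by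
    intro B0 hB0 hfg
    obtain ⟨D, hDC, hBD, hrk⟩ := hm (B0 ⊔ Subgroup.closure {x}) (sup_le_sup_right hB0 _)
      (hfg.sup ⟨{x}, by simp⟩)
    obtain ⟨g, hg⟩ := aux_rank_gen hrk
    have hgC : ∀ i, g i ∈ B ⊔ Subgroup.closure {x} :=
      fun i => hDC (hg ▸ Subgroup.subset_closure ⟨i, rfl⟩)
    let g1 : Fin m → (iotaAX A x).range := fun i => ⟨g i, hCR (hgC i)⟩
    let γ : Fin m → Γ := fun i => ρ (g1 i)
    have hγ : FreeGroup.lift γ = ρ.comp (FreeGroup.lift g1) := by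
      ext; simp [γ]
    have hg1 : (iotaAX A x).range.subtype.comp (FreeGroup.lift g1) = FreeGroup.lift g := by
      ext; simp [g1]
    have hD : ∀ d ∈ D, ∃ z, ∃ h : d ∈ (iotaAX A x).range,
        FreeGroup.lift g1 z = ⟨d, h⟩ := by
      intro d hd
      have hd' := hd
      rw [← hg, ← FreeGroup.range_lift_eq_closure] at hd'
      obtain ⟨z, hz⟩ := hd'
      refine ⟨z, hCR (hDC hd), Subtype.ext ?_⟩
      rw [← hg1] at hz
      exact hz
    obtain ⟨z, hxr, hz⟩ := hD x (hBD ((le_sup_right : _ ≤ B0 ⊔ Subgroup.closure {x})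
      (Subgroup.subset_closure (Set.mem_singleton x))))
    have hfree : IsFreeGroup (Subgroup.closure (Set.range γ)) :=
      hk _ ((aux_gen_rank γ rfl).trans (by simp))
    obtain ⟨k, hkr, hrank⟩ := aux_rank_lt γ hfree z
      (by
        rintro rfl
        rw [map_one] at hz
        exact hx1 (congrArg Subtype.val hz).symm)
      (by rw [hγ, MonoidHom.comp_apply, hz, hρx])
    refine ⟨k, hkr, _, ?_, ?_, hrank⟩
    · rw [Subgroup.closure_le]
      rintro _ ⟨i, rfl⟩
      exact hρC _ (hgC i)
    · intro b hb
      obtain ⟨y, hbr, hy⟩ := hD b (hBD ((le_sup_left : B0 ≤ B0 ⊔ Subgroup.closure {x}) hb))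
      rw [← FreeGroup.range_lift_eq_closure]
      refine ⟨y, ?_⟩
      rw [hγ, MonoidHom.comp_apply, hy, hρA b (hBA (hB0 hb))]
  obtain ⟨k0, hk0, -⟩ := main ⊥ bot_le ⟨∅, by simp⟩
  refine ⟨m - 1, by omega, fun B0 h1 h2 => ?_⟩
  obtain ⟨k, hk, E, h3, h4, h5⟩ := main B0 h1 h2
  refine ⟨E, h3, h4, h5.trans ?_⟩
  have : k ≤ m - 1 := by omega
  exact_mod_cast this

/-- If `B ≤ A`, `localRank B < ∞` and `A` is strongly closable, then every `B`-admissible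
element of `Γ` is `A`-admissible. -/
theorem admissible_mono {Γ : Type*} [Group Γ] (A B : Subgroup Γ) (hBA : B ≤ A)
    (hB : localRank B < ⊤) (hA : StronglyClosable A)
    (x : Γ) (hx : Admissible B x) : Admissible A x := by
  obtain ⟨hx1, hx2⟩ := hx
  unfold StronglyClosable at hx1 hA
  have hni : ¬ Function.Injective (iotaAX A x) := by
    intro hi
    obtain ⟨m, hm⟩ := ENat.ne_top_iff_exists.mp (hx2.trans_lt hB).ne
    have hk : KFree Γ m := fun H hH =>
      aux_kfree (hm ▸ hx1) H (hH.trans (by norm_cast; omega))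
    obtain ⟨k, hkm, hBk⟩ := aux_part2 A B hBA x m (aux_localRankLE hm.ge) hk hi
    have h1 := (hm.le.trans hx2).trans (aux_localRank_le hBk)
    norm_cast at h1
    omega
  obtain ⟨r, hr⟩ := ENat.ne_top_iff_exists.mp (hA.trans_le le_top).ne
  have key : localRank (A ⊔ Subgroup.closure {x}) ≤ localRank A := by
    rw [← hr]
    exact aux_localRank_le
      (aux_part1 A x r (aux_localRankLE hr.ge) (aux_kfree (hr ▸ hA)) hni)
  exact ⟨key.trans_lt hA, key⟩
end
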